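/- arXiv:1906.08471 — 3 statements merged into one kernel-verified Lean document; each statement's English description precedes it below -/
import Mathlib

section
/- Assume in addition that ξ(1) = 1 and let t > 0. For every Borel probability measure ν on [0,1], if μ denotes the pushforward of ν under the map r ↦ t ξ'(r), then ∫_{ℝ_+} ξ*(s/t) dμ(s) = ξ'(1) − 1 − ∫_0^1 s ξ''(s) ν([0,s]) ds, where ξ' and ξ'' denote the first and second derivatives of ξ. -/
open MeasureTheory

/-- The mixed `p`-spin correlation function `ξ(r) = ∑_{p=2}^n β_p r^p`. -/
noncomputable def xi (n : ℕ) (β : ℕ → ℝ) (r : ℝ) : ℝ :=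
  ∑ p ∈ Finset.Icc 2 n, β p * r ^ p

/-- The convex dual `ξ*(s) = sup_{r ≥ 0} (r s - ξ(r))`. -/
noncomputable def xiStar (n : ℕ) (β : ℕ → ℝ) (s : ℝ) : ℝ :=
  sSup ((fun r => r * s - xi n β r) '' Set.Ici 0)

theorem xi_contDiff (n : ℕ) (β : ℕ → ℝ) (k : ℕ∞) : ContDiff ℝ k (xi n β) := by
  unfold xi
  fun_prop

theorem xi_differentiable (n : ℕ) (β : ℕ → ℝ) : Differentiable ℝ (xi n β) :=
  (xi_contDiff n β 1).differentiable (by norm_num)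

theorem deriv_xi (n : ℕ) (β : ℕ → ℝ) (r : ℝ) :
    deriv (xi n β) r = ∑ p ∈ Finset.Icc 2 n, β p * (p * r ^ (p - 1)) := by
  have h : HasDerivAt (fun r => ∑ p ∈ Finset.Icc 2 n, β p * r ^ p)
      (∑ p ∈ Finset.Icc 2 n, β p * (p * r ^ (p - 1))) r :=
    HasDerivAt.fun_sum fun p _ => (hasDerivAt_pow p r).const_mul (β p)
  exact h.deriv

theorem contDiff_deriv_xi (n : ℕ) (β : ℕ → ℝ) : ContDiff ℝ 1 (deriv (xi n β)) :=
  ((contDiff_succ_iff_deriv (n := 1)).1 (xi_contDiff n β 2)).2.2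

theorem continuous_deriv_xi (n : ℕ) (β : ℕ → ℝ) : Continuous (deriv (xi n β)) :=
  (contDiff_deriv_xi n β).continuous

theorem continuous_deriv_deriv_xi (n : ℕ) (β : ℕ → ℝ) :
    Continuous (deriv (deriv (xi n β))) :=
  (contDiff_deriv_xi n β).continuous_deriv (by norm_num)

/-- The tangent line inequality for `r ↦ r ^ (m + 1)` on the half-line. -/
theorem pow_succ_tangent_le {a r : ℝ} (ha : 0 ≤ a) (hr : 0 ≤ r) (m : ℕ) :
    r * ((m + 1) * a ^ m) - r ^ (m + 1) ≤ m * a ^ (m + 1) := by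
  induction m with
  | zero => simp
  | succ m ih =>
    have h1 := mul_le_mul_of_nonneg_left ih hr
    have h2 : 0 ≤ (m + 1) * a ^ m * (r - a) ^ 2 := by positivity
    push_cast
    have e1 : a ^ (m + 1) = a ^ m * a := pow_succ _ _
    have e2 : a ^ (m + 1 + 1) = a ^ m * a * a := by rw [pow_succ, pow_succ]
    have e3 : r ^ (m + 1 + 1) = r ^ (m + 1) * r := pow_succ _ _
    rw [e1] at h1
    rw [e1, e2, e3]
    nlinarith

/-- The tangent line inequality for `ξ` on the half-line. -/
theorem xi_tangent_le (n : ℕ) (β : ℕ → ℝ) (hβ : ∀ p, 0 ≤ β p) {a r : ℝ} (ha : 0 ≤ a)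
    (hr : 0 ≤ r) :
    r * deriv (xi n β) a - xi n β r ≤ a * deriv (xi n β) a - xi n β a := by
  simp only [deriv_xi, xi, Finset.mul_sum, ← Finset.sum_sub_distrib]
  refine Finset.sum_le_sum fun p hp => ?_
  obtain ⟨m, rfl⟩ : ∃ m, p = m + 1 :=
    ⟨p - 1, by have := (Finset.mem_Icc.1 hp).1; omega⟩
  have h := mul_le_mul_of_nonneg_left (pow_succ_tangent_le ha hr m) (hβ (m + 1))
  simp only [Nat.add_sub_cancel]
  push_cast
  have e : a ^ (m + 1) = a ^ m * a := pow_succ _ _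
  rw [e] at h ⊢
  linarith

/-- The supremum defining `ξ*` is attained at `a` when the slope is that of `ξ` at `a`. -/
theorem xiStar_deriv (n : ℕ) (β : ℕ → ℝ) (hβ : ∀ p, 0 ≤ β p) {a : ℝ} (ha : 0 ≤ a) :
    xiStar n β (deriv (xi n β) a) = a * deriv (xi n β) a - xi n β a := by
  refine IsGreatest.csSup_eq ⟨⟨a, ha, rfl⟩, ?_⟩
  rintro _ ⟨r, hr, rfl⟩
  exact xi_tangent_le n β hβ ha hr

theorem exists_le_deriv_xi (n : ℕ) (β : ℕ → ℝ) (hβ : ∀ p, 0 ≤ β p)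
    (hβne : ∃ p ∈ Finset.Icc 2 n, β p ≠ 0) (s : ℝ) :
    ∃ a, 0 ≤ a ∧ s ≤ deriv (xi n β) a := by
  obtain ⟨p, hp, hp0⟩ := hβne
  have hpos : 0 < β p := lt_of_le_of_ne (hβ p) (Ne.symm hp0)
  have hp2 : 2 ≤ p := (Finset.mem_Icc.1 hp).1
  set a := max 1 (s / β p)
  have ha1 : 1 ≤ a := le_max_left _ _
  have ha0 : 0 ≤ a := zero_le_one.trans ha1
  refine ⟨a, ha0, ?_⟩
  rw [deriv_xi]
  have hle : β p * (p * a ^ (p - 1)) ≤ ∑ q ∈ Finset.Icc 2 n, β q * (q * a ^ (q - 1)) :=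
    Finset.single_le_sum (f := fun q : ℕ => β q * (q * a ^ (q - 1)))
      (fun q _ => mul_nonneg (hβ q) (by positivity)) hp
  refine le_trans ?_ hle
  have h1 : a ≤ a ^ (p - 1) := le_self_pow₀ ha1 (by omega)
  have h2 : (1 : ℝ) ≤ p := by exact_mod_cast (by omega : 1 ≤ p)
  have h3 : s / β p ≤ p * a ^ (p - 1) := by
    have : s / β p ≤ a := le_max_right _ _
    nlinarith
  rwa [div_le_iff₀' hpos] at h3

theorem xiStar_monotone (n : ℕ) (β : ℕ → ℝ) (hβ : ∀ p, 0 ≤ β p)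
    (hβne : ∃ p ∈ Finset.Icc 2 n, β p ≠ 0) : Monotone (xiStar n β) := by
  intro s s' hs
  have hbdd : BddAbove ((fun r => r * s' - xi n β r) '' Set.Ici 0) := by
    obtain ⟨a, ha, hsa⟩ := exists_le_deriv_xi n β hβ hβne s'
    refine ⟨a * deriv (xi n β) a - xi n β a, ?_⟩
    rintro _ ⟨r, hr, rfl⟩
    exact (sub_le_sub_right (mul_le_mul_of_nonneg_left hsa hr) _).trans
      (xi_tangent_le n β hβ ha hr)
  refine csSup_le (Set.nonempty_Ici.image _) ?_
  rintro _ ⟨r, hr, rfl⟩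
  exact (sub_le_sub_right (mul_le_mul_of_nonneg_left hs hr) _).trans
    (le_csSup hbdd ⟨r, hr, rfl⟩)

theorem integral_mul_deriv_deriv_xi (n : ℕ) (β : ℕ → ℝ) (r : ℝ) :
    ∫ s in r..1, s * deriv (deriv (xi n β)) s
      = (deriv (xi n β) 1 - xi n β 1) - (r * deriv (xi n β) r - xi n β r) := by
  have hd : ∀ x : ℝ, HasDerivAt (fun x => x * deriv (xi n β) x - xi n β x)
      (x * deriv (deriv (xi n β)) x) x := fun x => by
    have h1 := (hasDerivAt_id x).mul
      ((contDiff_deriv_xi n β).differentiable (by norm_num) x).hasDerivAt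
    have h2 := h1.sub (xi_differentiable n β x).hasDerivAt
    refine h2.congr_deriv ?_
    simp
  rw [intervalIntegral.integral_eq_sub_of_hasDerivAt (fun x _ => hd x)
    ((continuous_id.mul (continuous_deriv_deriv_xi n β)).intervalIntegrable _ _)]
  simp

/-- Fubini for the layers of a measure on `[0, 1]`. -/
theorem integral_tail_eq_integral_mul_measure (ν : Measure ℝ) [IsProbabilityMeasure ν]
    (hν : ∀ᵐ r ∂ν, r ∈ Set.Icc (0 : ℝ) 1) {g : ℝ → ℝ} (hg : Continuous g) :
    Integrable (fun r => ∫ s in r..1, g s) ν ∧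
    ∫ r, (∫ s in r..1, g s) ∂ν = ∫ s in (0:ℝ)..1, g s * (ν (Set.Icc 0 s)).toReal := by
  set F : ℝ → ℝ → ℝ := fun r s => {q : ℝ × ℝ | q.1 ≤ q.2}.indicator (fun q => g q.2) (r, s)
  have hT : MeasurableSet {q : ℝ × ℝ | q.1 ≤ q.2} := measurableSet_le measurable_fst measurable_snd
  have hgint : Integrable g (volume.restrict (Set.Ioc 0 1)) :=
    (hg.integrableOn_Icc (a := 0) (b := 1)).mono_set Set.Ioc_subset_Icc_self
  have hF : Integrable (Function.uncurry F) (ν.prod (volume.restrict (Set.Ioc 0 1))) :=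
    (hgint.comp_snd ν).indicator hT
  have hinner : (fun r => ∫ s in Set.Ioc (0:ℝ) 1, F r s) =ᵐ[ν] fun r => ∫ s in r..1, g s := by
    filter_upwards [hν] with r hr
    have h1 : F r = (Set.Ici r).indicator g := by
      ext s; simp [F, Set.indicator]
    rw [h1, ← integral_Icc_eq_integral_Ioc, setIntegral_indicator measurableSet_Ici,
      intervalIntegral.integral_of_le hr.2, ← integral_Icc_eq_integral_Ioc]
    congr 2
    ext s
    simp only [Set.mem_inter_iff, Set.mem_Icc, Set.mem_Ici]
    exact ⟨fun h => ⟨h.2, h.1.2⟩, fun h => ⟨⟨hr.1.trans h.1, h.2⟩, h.1⟩⟩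
  refine ⟨hF.integral_prod_left.congr hinner, ?_⟩
  rw [← integral_congr_ae hinner, integral_integral_swap hF,
    intervalIntegral.integral_of_le zero_le_one]
  refine integral_congr_ae (Filter.Eventually.of_forall fun s => ?_)
  have h1 : (fun r => F r s) = (Set.Iic s).indicator fun _ => g s := by
    ext r; simp [F, Set.indicator]
  have h2 : ν (Set.Iic s) = ν (Set.Icc 0 s) := by
    refine measure_congr ?_
    filter_upwards [hν] with r hr
    exact propext ⟨fun h => ⟨hr.1, h⟩, fun h => h.2⟩
  simp only [h1, integral_indicator measurableSet_Iic, setIntegral_const, smul_eq_mul,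
    Measure.real, h2]
  exact mul_comm _ _

/-- With the normalization `ξ(1) = 1` and `t > 0`: if `μ` is the pushforward of a Borel
probability measure `ν` on `[0,1]` under `r ↦ t ξ'(r)`, then
`∫ ξ*(s/t) dμ(s) = ξ'(1) - 1 - ∫_0^1 s ξ''(s) ν([0,s]) ds`. -/
theorem transport_cost_pushforward (n : ℕ) (hn : 2 ≤ n) (β : ℕ → ℝ) (hβ : ∀ p, 0 ≤ β p)
    (hβne : ∃ p ∈ Finset.Icc 2 n, β p ≠ 0) (hnorm : xi n β 1 = 1)
    (t : ℝ) (ht : 0 < t)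
    (ν : Measure ℝ) [IsProbabilityMeasure ν] (hν : ν (Set.Icc 0 1) = 1) :
    ∫ s, xiStar n β (s / t) ∂(ν.map fun r => t * deriv (xi n β) r)
      = deriv (xi n β) 1 - 1
        - ∫ s in (0:ℝ)..1, s * deriv (deriv (xi n β)) s * (ν (Set.Icc 0 s)).toReal := by
  have hae : ∀ᵐ r ∂ν, r ∈ Set.Icc (0 : ℝ) 1 :=
    (mem_ae_iff_prob_eq_one measurableSet_Icc).2 hν
  have hmeas : Measurable fun s => xiStar n β (s / t) :=
    (xiStar_monotone n β hβ hβne).measurable.comp (measurable_id.div_const t)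
  have hmap : Measurable fun r => t * deriv (xi n β) r :=
    (continuous_deriv_xi n β).measurable.const_mul t
  rw [integral_map hmap.aemeasurable hmeas.aestronglyMeasurable]
  have hcongr : (fun r => xiStar n β (t * deriv (xi n β) r / t)) =ᵐ[ν] fun r =>
      (deriv (xi n β) 1 - 1) - ∫ s in r..1, s * deriv (deriv (xi n β)) s := by
    filter_upwards [hae] with r hr
    rw [mul_div_cancel_left₀ _ ht.ne', xiStar_deriv n β hβ hr.1, integral_mul_deriv_deriv_xi,
      hnorm]
    ring
  obtain ⟨htail, heq⟩ := integral_tail_eq_integral_mul_measure ν hae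
    (g := fun s => s * deriv (deriv (xi n β)) s)
    (continuous_id.mul (continuous_deriv_deriv_xi n β))
  rw [integral_congr_ae hcongr, integral_sub (integrable_const _) htail, heq]
  simp
end

section
/- Let μ be a Borel probability measure on ℝ_+, and let q, q' ≥ 0 both satisfy μ([0,q]) = 1 and μ([0,q']) = 1. Define, for Q with μ([0,Q]) = 1, the quantity ψ°(Q) := inf { ∫_0^Q ( b − 2∫_s^Q μ([0,r]) dr )^{-1} ds + (b − 1 − log b)/2 − Q : b > 2∫_0^Q μ([0,r]) dr }. Then ψ°(q) = ψ°(q'). In other words, the right-hand side of the defining formula for ψ°(μ) does not depend on the choice of q with μ([0,q]) = 1. -/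
open MeasureTheory

/-- `ψ°(Q) = inf { ∫_0^Q (b - 2∫_s^Q μ([0,r]) dr)⁻¹ ds + (b - 1 - log b)/2 - Q :
b > 2∫_0^Q μ([0,r]) dr }`. -/
noncomputable def psiCirc (μ : Measure ℝ) (Q : ℝ) : ℝ :=
  sInf ((fun b => (∫ s in (0:ℝ)..Q, (b - 2 * ∫ r in s..Q, (μ (Set.Icc 0 r)).toReal)⁻¹)
      + (b - 1 - Real.log b) / 2 - Q) ''
    Set.Ioi (2 * ∫ r in (0:ℝ)..Q, (μ (Set.Icc 0 r)).toReal))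

/-- The cumulative distribution function `r ↦ μ([0,r])` is monotone. -/
theorem monotone_toReal_measure_Icc_zero (μ : Measure ℝ) [IsFiniteMeasure μ] :
    Monotone fun r : ℝ => (μ (Set.Icc 0 r)).toReal := fun _ _ h =>
  ENNReal.toReal_mono (measure_ne_top _ _) (measure_mono (Set.Icc_subset_Icc_right h))

/-- Beyond a point carrying full mass, the primitive of the cumulative distribution function is
affine with slope one. -/
theorem integral_measure_Icc_zero_eq_sub (μ : Measure ℝ) [IsProbabilityMeasure μ]
    {q s t : ℝ} (hμq : μ (Set.Icc 0 q) = 1) (hs : q ≤ s) (hst : s ≤ t) :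
    ∫ r in s..t, (μ (Set.Icc 0 r)).toReal = t - s := by
  have h : Set.EqOn (fun r : ℝ => (μ (Set.Icc 0 r)).toReal) (fun _ => (1 : ℝ)) (Set.uIcc s t) := by
    intro r hr
    rw [Set.uIcc_of_le hst] at hr
    have h1 : μ (Set.Icc 0 r) = 1 := le_antisymm prob_le_one
      (hμq ▸ measure_mono (Set.Icc_subset_Icc_right (hs.trans hr.1)))
    simp [h1]
  rw [intervalIntegral.integral_congr h]
  simp

theorem integral_inv_add_two_mul_sub {b q q' : ℝ} (hb : 0 < b) (h : q ≤ q') :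
    ∫ s in q..q', (b + 2 * (s - q))⁻¹ =
      (Real.log (b + 2 * (q' - q)) - Real.log b) / 2 := by
  have hpos : ∀ s ∈ Set.uIcc q q', 0 < b + 2 * (s - q) := by
    intro s hs
    rw [Set.uIcc_of_le h] at hs
    linarith [hs.1]
  rw [intervalIntegral.integral_eq_sub_of_hasDerivAt
    (f := fun s => Real.log (b + 2 * (s - q)) / 2)]
  · simp
    ring
  · intro s hs
    have hd : HasDerivAt (fun s => b + 2 * (s - q)) (2 * 1) s :=
      (((hasDerivAt_id s).sub_const q).const_mul 2).const_add b
    refine ((hd.log (hpos s hs).ne').div_const 2).congr_deriv ?_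
    rw [mul_one, div_right_comm, div_self two_ne_zero, one_div]
  · refine ContinuousOn.intervalIntegrable (ContinuousOn.inv₀ (by fun_prop) ?_)
    exact fun s hs => (hpos s hs).ne'

/-- Replacing `q` by a larger `q'` amounts to the substitution `b ↦ b + 2 (q' - q)`. -/
theorem psiCirc_eq_of_le (μ : Measure ℝ) [IsProbabilityMeasure μ]
    {q q' : ℝ} (hq : 0 ≤ q) (h : q ≤ q') (hμq : μ (Set.Icc 0 q) = 1) :
    psiCirc μ q = psiCirc μ q' := by
  have hF : ∀ a c : ℝ, IntervalIntegrable (fun r : ℝ => (μ (Set.Icc 0 r)).toReal) volume a c :=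
    fun a c => (monotone_toReal_measure_Icc_zero μ).intervalIntegrable
  have hF0 : ∀ r : ℝ, 0 ≤ (μ (Set.Icc 0 r)).toReal := fun r => ENNReal.toReal_nonneg
  have hsplit : ∀ s, ∫ r in s..q', (μ (Set.Icc 0 r)).toReal =
      (∫ r in s..q, (μ (Set.Icc 0 r)).toReal) + (q' - q) := by
    intro s
    rw [← intervalIntegral.integral_add_adjacent_intervals (hF s q) (hF q q'),
      integral_measure_Icc_zero_eq_sub μ hμq le_rfl h]
  have hset : Set.Ioi (2 * ∫ r in (0:ℝ)..q', (μ (Set.Icc 0 r)).toReal) =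
      (fun b => b + 2 * (q' - q)) '' Set.Ioi (2 * ∫ r in (0:ℝ)..q, (μ (Set.Icc 0 r)).toReal) := by
    rw [Set.image_add_const_Ioi, hsplit, mul_add]
  unfold psiCirc
  rw [hset, Set.image_image]
  congr 1
  refine Set.image_congr fun b hb => ?_
  rw [Set.mem_Ioi] at hb
  have hpos : ∀ s ∈ Set.uIcc 0 q, 0 < b - 2 * ∫ r in s..q, (μ (Set.Icc 0 r)).toReal := by
    intro s hs
    rw [Set.uIcc_of_le hq] at hs
    have h1 := intervalIntegral.integral_add_adjacent_intervals (hF 0 s) (hF s q)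
    have h2 := intervalIntegral.integral_nonneg (μ := volume) hs.1 fun r _ => hF0 r
    linarith
  have hb0 : 0 < b := by simpa using hpos q Set.right_mem_uIcc
  have hleft : Set.EqOn
      (fun s => (b + 2 * (q' - q) - 2 * ∫ r in s..q', (μ (Set.Icc 0 r)).toReal)⁻¹)
      (fun s => (b - 2 * ∫ r in s..q, (μ (Set.Icc 0 r)).toReal)⁻¹) (Set.uIcc 0 q) := by
    intro s _
    simp only [hsplit s]
    congr 1
    ring
  have hright : Set.EqOn
      (fun s => (b + 2 * (q' - q) - 2 * ∫ r in s..q', (μ (Set.Icc 0 r)).toReal)⁻¹)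
      (fun s => (b + 2 * (s - q))⁻¹) (Set.uIcc q q') := by
    intro s hs
    rw [Set.uIcc_of_le h] at hs
    simp only [integral_measure_Icc_zero_eq_sub μ hμq hs.1 hs.2]
    congr 1
    ring
  have hcont : Continuous fun s => ∫ r in s..q, (μ (Set.Icc 0 r)).toReal := by
    simp_rw [intervalIntegral.integral_symm q]
    exact (intervalIntegral.continuous_primitive hF q).neg
  have hintl : IntervalIntegrable
      (fun s => (b + 2 * (q' - q) - 2 * ∫ r in s..q', (μ (Set.Icc 0 r)).toReal)⁻¹)
      volume 0 q := by
    refine ContinuousOn.intervalIntegrable (ContinuousOn.congr ?_ hleft)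
    exact ContinuousOn.inv₀ (by fun_prop) fun s hs => (hpos s hs).ne'
  have hintr : IntervalIntegrable
      (fun s => (b + 2 * (q' - q) - 2 * ∫ r in s..q', (μ (Set.Icc 0 r)).toReal)⁻¹)
      volume q q' := by
    refine ContinuousOn.intervalIntegrable (ContinuousOn.congr ?_ hright)
    refine ContinuousOn.inv₀ (by fun_prop) fun s hs => ?_
    rw [Set.uIcc_of_le h] at hs
    linarith [hs.1]
  rw [← intervalIntegral.integral_add_adjacent_intervals hintl hintr,
    intervalIntegral.integral_congr hleft, intervalIntegral.integral_congr hright,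
    integral_inv_add_two_mul_sub hb0 h]
  ring

/-- The value `ψ°(q)` does not depend on the choice of `q ≥ 0` with `μ([0,q]) = 1`. -/
theorem psiCirc_well_defined (μ : Measure ℝ) [IsProbabilityMeasure μ]
    (q q' : ℝ) (hq : 0 ≤ q) (hq' : 0 ≤ q')
    (hμq : μ (Set.Icc 0 q) = 1) (hμq' : μ (Set.Icc 0 q') = 1) :
    psiCirc μ q = psiCirc μ q' := by
  rcases le_total q q' with h | h
  · exact psiCirc_eq_of_le μ hq h hμq
  · exact (psiCirc_eq_of_le μ hq' h hμq').symm
end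

section
/- Let k ≥ 1, let ψ : ℝ_+^k → ℝ be Lipschitz continuous, and define, for t > 0 and x ∈ ℝ_+^k, f(t,x) := sup_{y ∈ ℝ_+^k} ( ψ(y) − (t/k) ∑_{ℓ=1}^k ξ*((y_ℓ − x_ℓ)/t) ). Then at every point (t,x) ∈ (0,∞) × (0,∞)^k at which f is differentiable, one has ∂_{x_ℓ} f(t,x) ≥ 0 for every ℓ ∈ {1,…,k}, and ∂_t f(t,x) − (1/k) ∑_{ℓ=1}^k ξ( k ∂_{x_ℓ} f(t,x) ) = 0. -/
open MeasureTheory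

/-- The finite-dimensional Hopf-Lax function
`f(t,x) = sup_{y ∈ ℝ₊^k} (ψ(y) - (t/k) ∑_ℓ ξ*((y_ℓ - x_ℓ)/t))`. -/
noncomputable def hopfLax (n : ℕ) (β : ℕ → ℝ) (k : ℕ) (ψ : (Fin k → ℝ) → ℝ)
    (t : ℝ) (x : Fin k → ℝ) : ℝ :=
  sSup ((fun y => ψ y - (t / k) * ∑ ℓ, xiStar n β ((y ℓ - x ℓ) / t)) ''
    {y : Fin k → ℝ | ∀ ℓ, 0 ≤ y ℓ})

section XiStar

variable {n : ℕ} {β : ℕ → ℝ}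

theorem pow_tangent_le {a r : ℝ} (ha : 0 ≤ a) (hr : 0 ≤ r) (p : ℕ) :
    (p + 1) * a ^ p * (r - a) ≤ r ^ (p + 1) - a ^ (p + 1) := by
  induction p with
  | zero => simp
  | succ p ih =>
    have h1 := mul_le_mul_of_nonneg_left ih hr
    have h2 : 0 ≤ (p + 1) * a ^ p * (r - a) ^ 2 := by positivity
    push_cast
    linear_combination h1 + h2

theorem exists_xi_supporting_slope (hβ : ∀ p, 0 ≤ β p) {a : ℝ} (ha : 0 ≤ a) :
    ∃ v : ℝ, ∀ r, 0 ≤ r → r * v - xi n β r ≤ a * v - xi n β a := by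
  refine ⟨∑ p ∈ Finset.Icc 2 n, β p * (p * a ^ (p - 1)), fun r hr => ?_⟩
  have h : ∑ p ∈ Finset.Icc 2 n, β p * (p * a ^ (p - 1)) * (r - a) ≤
      ∑ p ∈ Finset.Icc 2 n, (β p * r ^ p - β p * a ^ p) := by
    refine Finset.sum_le_sum fun p hp => ?_
    obtain ⟨q, rfl⟩ : ∃ q, p = q + 1 := ⟨p - 1, by grind⟩
    have := mul_le_mul_of_nonneg_left (pow_tangent_le ha hr q) (hβ (q + 1))
    push_cast
    linarith
  rw [← Finset.sum_mul, Finset.sum_sub_distrib] at h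
  simp only [xi]
  linarith

theorem bddAbove_xiStar (hβ : ∀ p, 0 ≤ β p) (hβne : ∃ p ∈ Finset.Icc 2 n, β p ≠ 0) (s : ℝ) :
    BddAbove ((fun r => r * s - xi n β r) '' Set.Ici 0) := by
  obtain ⟨p, hp, hp0⟩ := hβne
  have hb : 0 < β p := lt_of_le_of_ne (hβ p) hp0.symm
  refine ⟨s ^ 2 / (4 * β p) + β p, ?_⟩
  rintro _ ⟨r, hr, rfl⟩
  have hr : 0 ≤ r := hr
  have h1 : β p * r ^ p ≤ xi n β r :=
    Finset.single_le_sum (f := fun p => β p * r ^ p)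
      (fun q _ => mul_nonneg (hβ q) (pow_nonneg hr q)) hp
  have h2 : r ^ 2 - 1 ≤ r ^ p := by
    rcases le_total 1 r with h | h
    · linarith [pow_le_pow_right₀ h (Finset.mem_Icc.1 hp).1]
    · nlinarith [pow_nonneg hr p]
  have h3 := mul_le_mul_of_nonneg_left h2 hb.le
  have h4 : r * s - β p * r ^ 2 ≤ s ^ 2 / (4 * β p) := by
    rw [le_div_iff₀ (by positivity)]
    nlinarith [sq_nonneg (2 * β p * r - s)]
  dsimp only
  linarith

/-- The Fenchel–Young inequality. -/
theorem mul_sub_xi_le_xiStar (hβ : ∀ p, 0 ≤ β p) (hβne : ∃ p ∈ Finset.Icc 2 n, β p ≠ 0)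
    {r : ℝ} (hr : 0 ≤ r) (s : ℝ) : r * s - xi n β r ≤ xiStar n β s :=
  le_csSup (bddAbove_xiStar hβ hβne s) ⟨r, hr, rfl⟩

theorem xiStar_le {s M : ℝ} (h : ∀ r, 0 ≤ r → r * s - xi n β r ≤ M) : xiStar n β s ≤ M := by
  refine csSup_le (Set.nonempty_Ici.image _) ?_
  rintro _ ⟨r, hr, rfl⟩
  exact h r hr

theorem monotone_xiStar (hβ : ∀ p, 0 ≤ β p) (hβne : ∃ p ∈ Finset.Icc 2 n, β p ≠ 0) :
    Monotone (xiStar n β) := fun _ s' h =>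
  xiStar_le fun _ hr => (sub_le_sub_right (mul_le_mul_of_nonneg_left h hr) _).trans
    (mul_sub_xi_le_xiStar hβ hβne hr s')

theorem convexOn_xiStar (hβ : ∀ p, 0 ≤ β p) (hβne : ∃ p ∈ Finset.Icc 2 n, β p ≠ 0) :
    ConvexOn ℝ Set.univ (xiStar n β) := by
  refine ⟨convex_univ, fun u _ v _ a b ha hb hab => xiStar_le fun r hr => ?_⟩
  have hu := mul_le_mul_of_nonneg_left (mul_sub_xi_le_xiStar hβ hβne hr u) ha
  have hv := mul_le_mul_of_nonneg_left (mul_sub_xi_le_xiStar hβ hβne hr v) hb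
  simp only [smul_eq_mul]
  linear_combination hu + hv + xi n β r * hab

theorem continuous_xiStar (hβ : ∀ p, 0 ≤ β p) (hβne : ∃ p ∈ Finset.Icc 2 n, β p ≠ 0) :
    Continuous (xiStar n β) := by
  rw [← continuousOn_univ]
  exact (convexOn_xiStar hβ hβne).continuousOn isOpen_univ

end XiStar

section HopfLax

variable {n : ℕ} {β : ℕ → ℝ} {k : ℕ} {ψ : (Fin k → ℝ) → ℝ} {C : NNReal}

theorem hopfLax_objective_le (hβ : ∀ p, 0 ≤ β p) (hβne : ∃ p ∈ Finset.Icc 2 n, β p ≠ 0)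
    (hk : 1 ≤ k) (hψ : LipschitzOnWith C ψ {y : Fin k → ℝ | ∀ ℓ, 0 ≤ y ℓ})
    {t : ℝ} (ht : 0 < t) (x : Fin k → ℝ) {y : Fin k → ℝ} (hy : ∀ ℓ, 0 ≤ y ℓ) :
    ψ y - (t / k) * ∑ ℓ, xiStar n β ((y ℓ - x ℓ) / t) ≤
      ψ 0 + (C + 1) * ∑ ℓ, x ℓ + t * xi n β (k * (C + 1)) - ‖y‖ := by
  have hk0 : (0 : ℝ) < k := by exact_mod_cast hk
  have hC : (0 : ℝ) ≤ C := C.2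
  have h1 : ψ y ≤ ψ 0 + C * ‖y‖ := by
    have := hψ.dist_le_mul y hy 0 (fun ℓ => le_rfl)
    rw [Real.dist_eq, dist_zero_right] at this
    linarith [le_abs_self (ψ y - ψ 0)]
  have h2 : ‖y‖ ≤ ∑ ℓ, y ℓ := by
    refine (pi_norm_le_iff_of_nonneg (Finset.sum_nonneg fun ℓ _ => hy ℓ)).2 fun ℓ => ?_
    rw [Real.norm_of_nonneg (hy ℓ)]
    exact Finset.single_le_sum (fun i _ => hy i) (Finset.mem_univ ℓ)
  have h3 : ∑ ℓ, (k * (C + 1) * ((y ℓ - x ℓ) / t) - xi n β (k * (C + 1))) ≤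
      ∑ ℓ, xiStar n β ((y ℓ - x ℓ) / t) :=
    Finset.sum_le_sum fun ℓ _ => mul_sub_xi_le_xiStar hβ hβne (by positivity) _
  rw [Finset.sum_sub_distrib, ← Finset.mul_sum, ← Finset.sum_div, Finset.sum_sub_distrib] at h3
  simp only [Finset.sum_const, Finset.card_univ, Fintype.card_fin, nsmul_eq_mul] at h3
  have h4 := mul_le_mul_of_nonneg_left h3 (show (0 : ℝ) ≤ t / k by positivity)
  have h5 : t / k * (k * (C + 1) * ((∑ ℓ, y ℓ - ∑ ℓ, x ℓ) / t) - k * xi n β (k * (C + 1))) =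
      (C + 1) * (∑ ℓ, y ℓ - ∑ ℓ, x ℓ) - t * xi n β (k * (C + 1)) := by
    field_simp
  rw [h5] at h4
  nlinarith [mul_le_mul_of_nonneg_left h2 (show (0 : ℝ) ≤ C + 1 by positivity)]

theorem objective_le_hopfLax (hβ : ∀ p, 0 ≤ β p) (hβne : ∃ p ∈ Finset.Icc 2 n, β p ≠ 0)
    (hk : 1 ≤ k) (hψ : LipschitzOnWith C ψ {y : Fin k → ℝ | ∀ ℓ, 0 ≤ y ℓ})
    {t : ℝ} (ht : 0 < t) (x : Fin k → ℝ) {y : Fin k → ℝ} (hy : ∀ ℓ, 0 ≤ y ℓ) :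
    ψ y - (t / k) * ∑ ℓ, xiStar n β ((y ℓ - x ℓ) / t) ≤ hopfLax n β k ψ t x := by
  refine le_csSup ⟨ψ 0 + (C + 1) * ∑ ℓ, x ℓ + t * xi n β (k * (C + 1)), ?_⟩ ⟨y, hy, rfl⟩
  rintro _ ⟨z, hz, rfl⟩
  have := hopfLax_objective_le hβ hβne hk hψ ht x hz
  dsimp only
  linarith [norm_nonneg z]

theorem hopfLax_le {t M : ℝ} {x : Fin k → ℝ} (h : ∀ y : Fin k → ℝ, (∀ ℓ, 0 ≤ y ℓ) →
      ψ y - (t / k) * ∑ ℓ, xiStar n β ((y ℓ - x ℓ) / t) ≤ M) :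
    hopfLax n β k ψ t x ≤ M := by
  refine csSup_le (Set.Nonempty.image _ ⟨0, fun ℓ => le_rfl⟩) ?_
  rintro _ ⟨y, hy, rfl⟩
  exact h y hy

theorem hopfLax_mono (hβ : ∀ p, 0 ≤ β p) (hβne : ∃ p ∈ Finset.Icc 2 n, β p ≠ 0)
    (hk : 1 ≤ k) (hψ : LipschitzOnWith C ψ {y : Fin k → ℝ | ∀ ℓ, 0 ≤ y ℓ})
    {t : ℝ} (ht : 0 < t) : Monotone (hopfLax n β k ψ t) := fun x x' hx =>
  hopfLax_le fun y hy => by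
    refine le_trans ?_ (objective_le_hopfLax hβ hβne hk hψ ht x' hy)
    have : ∑ ℓ, xiStar n β ((y ℓ - x' ℓ) / t) ≤ ∑ ℓ, xiStar n β ((y ℓ - x ℓ) / t) :=
      Finset.sum_le_sum fun ℓ _ => monotone_xiStar hβ hβne
        (div_le_div_of_nonneg_right (sub_le_sub_left (hx ℓ) _) ht.le)
    exact sub_le_sub_left (mul_le_mul_of_nonneg_left this (by positivity)) _

/-- The dynamic programming inequality, forwards in time. -/
theorem hopfLax_sub_le_hopfLax_add (hβ : ∀ p, 0 ≤ β p)
    (hβne : ∃ p ∈ Finset.Icc 2 n, β p ≠ 0)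
    (hk : 1 ≤ k) (hψ : LipschitzOnWith C ψ {y : Fin k → ℝ | ∀ ℓ, 0 ≤ y ℓ})
    {t s : ℝ} (ht : 0 < t) (hs : 0 < s) (x v : Fin k → ℝ) :
    hopfLax n β k ψ t x - s * ((1 / k) * ∑ ℓ, xiStar n β (v ℓ)) ≤
      hopfLax n β k ψ (t + s) (x - s • v) := by
  rw [sub_le_iff_le_add]
  refine hopfLax_le fun y hy => ?_
  have h := objective_le_hopfLax hβ hβne hk hψ (add_pos ht hs) (x - s • v) hy
  have hts : 0 < t + s := add_pos ht hs
  have key : (t + s) * ∑ ℓ, xiStar n β ((y ℓ - (x - s • v) ℓ) / (t + s)) ≤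
      t * ∑ ℓ, xiStar n β ((y ℓ - x ℓ) / t) + s * ∑ ℓ, xiStar n β (v ℓ) := by
    rw [Finset.mul_sum, Finset.mul_sum, Finset.mul_sum, ← Finset.sum_add_distrib]
    refine Finset.sum_le_sum fun ℓ _ => ?_
    have hc := (convexOn_xiStar hβ hβne).2 (Set.mem_univ ((y ℓ - x ℓ) / t)) (Set.mem_univ (v ℓ))
      (show 0 ≤ t / (t + s) by positivity) (show 0 ≤ s / (t + s) by positivity)
      (by field_simp)
    have he : (y ℓ - (x - s • v) ℓ) / (t + s) =
        (t / (t + s)) • ((y ℓ - x ℓ) / t) + (s / (t + s)) • v ℓ := by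
      simp only [Pi.sub_apply, Pi.smul_apply, smul_eq_mul]
      field_simp
      ring
    rw [he]
    refine (mul_le_mul_of_nonneg_left hc hts.le).trans_eq ?_
    simp only [smul_eq_mul]
    field_simp
  have key' := mul_le_mul_of_nonneg_left key (show (0 : ℝ) ≤ 1 / k by positivity)
  linear_combination h + key'

theorem exists_hopfLax_eq (hβ : ∀ p, 0 ≤ β p) (hβne : ∃ p ∈ Finset.Icc 2 n, β p ≠ 0)
    (hk : 1 ≤ k) (hψ : LipschitzOnWith C ψ {y : Fin k → ℝ | ∀ ℓ, 0 ≤ y ℓ})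
    {t : ℝ} (ht : 0 < t) (x : Fin k → ℝ) :
    ∃ y : Fin k → ℝ, (∀ ℓ, 0 ≤ y ℓ) ∧
      hopfLax n β k ψ t x = ψ y - (t / k) * ∑ ℓ, xiStar n β ((y ℓ - x ℓ) / t) := by
  have hclosed : IsClosed {y : Fin k → ℝ | ∀ ℓ, 0 ≤ y ℓ} := by
    simp only [Set.ofPred_forall]
    exact isClosed_iInter fun ℓ => isClosed_le continuous_const (continuous_apply ℓ)
  have hξ := continuous_xiStar hβ hβne
  have hcont : ContinuousOn (fun y => ψ y - (t / k) * ∑ ℓ, xiStar n β ((y ℓ - x ℓ) / t))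
      {y : Fin k → ℝ | ∀ ℓ, 0 ≤ y ℓ} := hψ.continuousOn.sub (by fun_prop)
  obtain ⟨y, hy, hmax⟩ := hcont.exists_isMaxOn' hclosed (x₀ := 0) (fun ℓ => le_rfl) (by
    have hlarge := (tendsto_norm_cocompact_atTop (E := Fin k → ℝ)).eventually_ge_atTop
      (ψ 0 + (C + 1) * ∑ ℓ, x ℓ + t * xi n β (k * (C + 1)) -
        (ψ 0 - (t / k) * ∑ ℓ, xiStar n β (((0 : Fin k → ℝ) ℓ - x ℓ) / t)))
    filter_upwards [hlarge.filter_mono inf_le_left,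
      (Filter.mem_inf_of_right (Filter.mem_principal_self _) :
        {y : Fin k → ℝ | ∀ ℓ, 0 ≤ y ℓ} ∈ _)] with z hz hz0
    linarith [hopfLax_objective_le hβ hβne hk hψ ht x hz0])
  exact ⟨y, hy, le_antisymm (hopfLax_le fun z hz => hmax hz)
    (objective_le_hopfLax hβ hβne hk hψ ht x hy)⟩

/-- The dynamic programming inequality, backwards in time along an optimal trajectory. -/
theorem exists_hopfLax_add_le_hopfLax_sub (hβ : ∀ p, 0 ≤ β p)
    (hβne : ∃ p ∈ Finset.Icc 2 n, β p ≠ 0)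
    (hk : 1 ≤ k) (hψ : LipschitzOnWith C ψ {y : Fin k → ℝ | ∀ ℓ, 0 ≤ y ℓ})
    {t : ℝ} (ht : 0 < t) (x : Fin k → ℝ) :
    ∃ v : Fin k → ℝ, ∀ s < t,
      hopfLax n β k ψ t x + s * ((1 / k) * ∑ ℓ, xiStar n β (v ℓ)) ≤
        hopfLax n β k ψ (t - s) (x + s • v) := by
  obtain ⟨y, hy, he⟩ := exists_hopfLax_eq hβ hβne hk hψ ht x
  refine ⟨fun ℓ => (y ℓ - x ℓ) / t, fun s hs => ?_⟩
  have hts : 0 < t - s := sub_pos.2 hs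
  have h := objective_le_hopfLax hβ hβne hk hψ hts
    (x + s • fun ℓ => (y ℓ - x ℓ) / t) hy
  have hv (ℓ : Fin k) : (y ℓ - (x + s • fun ℓ => (y ℓ - x ℓ) / t) ℓ) / (t - s) =
      (y ℓ - x ℓ) / t := by
    simp only [Pi.add_apply, Pi.smul_apply, smul_eq_mul]
    field_simp
    ring
  simp only [hv] at h
  rw [he]
  linear_combination h

end HopfLax

theorem HasFDerivAt.le_apply_of_eventually {E : Type*} [NormedAddCommGroup E] [NormedSpace ℝ E]
    {F : E → ℝ} {L : E →L[ℝ] ℝ} {z : E} (hF : HasFDerivAt F L z) {d : E} {c : ℝ}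
    (h : ∀ᶠ s in nhdsWithin (0 : ℝ) (Set.Ioi 0), F z + s * c ≤ F (z + s • d)) : c ≤ L d := by
  have hd : HasDerivAt (fun s : ℝ => F (z + s • d)) (L d) 0 := hF.hasLineDerivAt d
  refine ge_of_tendsto hd.tendsto_slope_zero_right ?_
  filter_upwards [h, self_mem_nhdsWithin] with s hs hs0
  have hs0 : 0 < s := hs0
  simp only [zero_add, zero_smul, add_zero, smul_eq_mul]
  rw [le_inv_mul_iff₀ hs0]
  linarith

theorem ContinuousLinearMap.apply_prod_pi {k : ℕ} (L : ℝ × (Fin k → ℝ) →L[ℝ] ℝ) (τ : ℝ)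
    (w : Fin k → ℝ) : L (τ, w) = τ * L (1, 0) + ∑ ℓ, w ℓ * L (0, Pi.single ℓ 1) := by
  have h1 : ((τ, w) : ℝ × (Fin k → ℝ)) =
      τ • ((1, 0) : ℝ × (Fin k → ℝ)) + ContinuousLinearMap.inr ℝ ℝ (Fin k → ℝ) w := by
    simp
  have h2 : w = ∑ ℓ, w ℓ • (Pi.single ℓ 1 : Fin k → ℝ) := pi_eq_sum_univ' w
  rw [h1, map_add, map_smul, smul_eq_mul]
  congr 1
  conv_lhs => rw [h2]
  simp only [map_sum, map_smul, smul_eq_mul, ContinuousLinearMap.inr_apply]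

/-- Equation (5.6) of the paper: at every point `(t,x) ∈ (0,∞) × (0,∞)^k` of
differentiability of the Hopf-Lax function `f`, we have `∂_{x_ℓ} f(t,x) ≥ 0` for
every `ℓ`, and `∂_t f(t,x) - (1/k) ∑_ℓ ξ(k ∂_{x_ℓ} f(t,x)) = 0`. -/
theorem hopfLax_solves_hj (n : ℕ) (hn : 2 ≤ n) (β : ℕ → ℝ) (hβ : ∀ p, 0 ≤ β p)
    (hβne : ∃ p ∈ Finset.Icc 2 n, β p ≠ 0)
    (k : ℕ) (hk : 1 ≤ k) (ψ : (Fin k → ℝ) → ℝ) (C : NNReal)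
    (hψ : LipschitzOnWith C ψ {y : Fin k → ℝ | ∀ ℓ, 0 ≤ y ℓ})
    (t : ℝ) (ht : 0 < t) (x : Fin k → ℝ) (hx : ∀ ℓ, 0 < x ℓ)
    (hdiff : DifferentiableAt ℝ
      (fun p : ℝ × (Fin k → ℝ) => hopfLax n β k ψ p.1 p.2) (t, x)) :
    (∀ ℓ : Fin k, 0 ≤ fderiv ℝ (fun p : ℝ × (Fin k → ℝ) => hopfLax n β k ψ p.1 p.2)
        (t, x) (0, Pi.single ℓ 1)) ∧
    fderiv ℝ (fun p : ℝ × (Fin k → ℝ) => hopfLax n β k ψ p.1 p.2) (t, x) (1, 0)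
      - (1 / k) * ∑ ℓ : Fin k,
          xi n β (k * fderiv ℝ (fun p : ℝ × (Fin k → ℝ) => hopfLax n β k ψ p.1 p.2)
            (t, x) (0, Pi.single ℓ 1)) = 0 := by
  set F : ℝ × (Fin k → ℝ) → ℝ := fun p => hopfLax n β k ψ p.1 p.2 with hFdef
  have hF : HasFDerivAt F (fderiv ℝ F (t, x)) (t, x) := hdiff.hasFDerivAt
  set L := fderiv ℝ F (t, x)
  have hpos : ∀ ℓ : Fin k, 0 ≤ L (0, Pi.single ℓ 1) := fun ℓ => by
    refine hF.le_apply_of_eventually ?_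
    filter_upwards [self_mem_nhdsWithin] with s hs
    have hs : 0 < s := hs
    have hle : x ≤ x + s • (Pi.single ℓ 1 : Fin k → ℝ) :=
      le_add_of_nonneg_right (smul_nonneg hs.le (Pi.single_nonneg.2 zero_le_one))
    simpa [hFdef] using hopfLax_mono hβ hβne hk hψ ht hle
  have hk0 : (0 : ℝ) < k := by exact_mod_cast hk
  have hkpos (ℓ : Fin k) : 0 ≤ k * L (0, Pi.single ℓ 1) := mul_nonneg hk0.le (hpos ℓ)
  refine ⟨hpos, sub_eq_zero.2 (le_antisymm ?_ ?_)⟩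
  · obtain ⟨v, hv⟩ := exists_hopfLax_add_le_hopfLax_sub hβ hβne hk hψ ht x
    have hder : (1 / k) * ∑ ℓ, xiStar n β (v ℓ) ≤ L (-1, v) := by
      refine hF.le_apply_of_eventually ?_
      filter_upwards [nhdsWithin_le_nhds (Iio_mem_nhds ht)] with s hs
      simpa [hFdef, sub_eq_add_neg] using hv s hs
    rw [L.apply_prod_pi] at hder
    have hFY : ∑ ℓ, (k * L (0, Pi.single ℓ 1) * v ℓ - xi n β (k * L (0, Pi.single ℓ 1))) ≤
        ∑ ℓ, xiStar n β (v ℓ) :=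
      Finset.sum_le_sum fun ℓ _ => mul_sub_xi_le_xiStar hβ hβne (hkpos ℓ) _
    have hFY' := mul_le_mul_of_nonneg_left hFY (one_div_nonneg.2 hk0.le)
    have hsum : (1 / k) * ∑ ℓ, k * L (0, Pi.single ℓ 1) * v ℓ =
        ∑ ℓ, v ℓ * L (0, Pi.single ℓ 1) := by
      rw [Finset.mul_sum]
      exact Finset.sum_congr rfl fun ℓ _ => by field_simp
    rw [Finset.sum_sub_distrib, mul_sub, hsum] at hFY'
    linarith
  · choose v hv using fun ℓ => exists_xi_supporting_slope (n := n) hβ (hkpos ℓ)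
    have hder : -((1 / k) * ∑ ℓ, xiStar n β (v ℓ)) ≤ L (1, -v) := by
      refine hF.le_apply_of_eventually ?_
      filter_upwards [self_mem_nhdsWithin] with s hs
      simpa [hFdef, sub_eq_add_neg] using
        hopfLax_sub_le_hopfLax_add hβ hβne hk hψ ht hs x v
    rw [L.apply_prod_pi] at hder
    have hFY : ∑ ℓ, xiStar n β (v ℓ) ≤
        ∑ ℓ, (k * L (0, Pi.single ℓ 1) * v ℓ - xi n β (k * L (0, Pi.single ℓ 1))) :=
      Finset.sum_le_sum fun ℓ _ => xiStar_le (hv ℓ)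
    have hFY' := mul_le_mul_of_nonneg_left hFY (one_div_nonneg.2 hk0.le)
    have hsum : (1 / k) * ∑ ℓ, k * L (0, Pi.single ℓ 1) * v ℓ =
        ∑ ℓ, v ℓ * L (0, Pi.single ℓ 1) := by
      rw [Finset.mul_sum]
      exact Finset.sum_congr rfl fun ℓ _ => by field_simp
    rw [Finset.sum_sub_distrib, mul_sub, hsum] at hFY'
    simp only [Pi.neg_apply, neg_mul, Finset.sum_neg_distrib] at hder
    linarith
end
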